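/- Let (Ω,μ,T) be a weak mixing probability measure-preserving system, let α ∈ (0,1) be irrational, let I ⊆ [0,1) be a finite union of intervals, and let (F_k)_{k∈ℕ} be a uniformly bounded sequence of measurable functions on Ω with F_k → F μ-almost surely. Then there is a set Ω' ⊆ Ω of full μ-measure such that for all ω ∈ Ω' and all t ∈ [0,1): (1/N) ∑_{k=1}^N 𝟙_I({t+kα}) · F_k(T^{l_k(t)} ω) → λ(I) · E_μ[F] as N → ∞. -/

import Mathlib

open MeasureTheory Filter Topology

/-- A probability measure-preserving system `(Ω, μ, T)` is weak mixing if the product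
system `(Ω × Ω, μ × μ, T × T)` is ergodic. -/
def WeakMixing {Ω : Type*} [MeasurableSpace Ω] (T : Ω → Ω) (μ : Measure Ω) : Prop :=
  Ergodic (Prod.map T T) (μ.prod μ)

/-- `l_k(t) = ⌊t + α k⌋` (as a natural number). -/
noncomputable def lk (α t : ℝ) (k : ℕ) : ℕ := (⌊t + α * k⌋).toNat

/-- A finite union of (half-open) intervals in `ℝ`. -/
def IsFinUnionIntervals (I : Set ℝ) : Prop :=
  ∃ s : Finset (ℝ × ℝ), I = ⋃ p ∈ s, Set.Ico p.1 p.2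

/-- The running maximum of the Birkhoff sums of lengths `1, …, n + 1`. -/
noncomputable def birkhoffMax {X : Type*} (S : X → X) (f : X → ℝ) : ℕ → X → ℝ
  | 0 => f
  | n + 1 => fun x => f x + max 0 (birkhoffMax S f n (S x))

section birkhoffMax

variable {X : Type*} {S : X → X} {f : X → ℝ}

lemma birkhoffMax_le_succ (n : ℕ) (x : X) :
    birkhoffMax S f n x ≤ birkhoffMax S f (n + 1) x := by
  induction n generalizing x with
  | zero => simp [birkhoffMax]
  | succ n ih =>
    have := max_le_max_left 0 (ih (S x))
    simp only [birkhoffMax] at this ⊢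
    linarith

lemma birkhoffMax_mono (x : X) : Monotone fun n => birkhoffMax S f n x :=
  monotone_nat_of_le_succ fun n => birkhoffMax_le_succ n x

lemma birkhoffSum_succ_le_birkhoffMax (n : ℕ) (x : X) :
    birkhoffSum S f (n + 1) x ≤ birkhoffMax S f n x := by
  induction n generalizing x with
  | zero => simp [birkhoffMax]
  | succ n ih =>
    rw [birkhoffSum_succ']
    have := (ih (S x)).trans (le_max_right 0 _)
    simp only [birkhoffMax]
    linarith

lemma tendsto_birkhoffMax_atTop {x : X}
    (hx : ¬ BddAbove (Set.range fun n => birkhoffSum S f n x)) :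
    Tendsto (fun n => birkhoffMax S f n x) atTop atTop := by
  refine tendsto_atTop_atTop_of_monotone (birkhoffMax_mono x) fun b => ?_
  by_contra! h
  refine hx ⟨max 0 b, ?_⟩
  rintro _ ⟨n, rfl⟩
  rcases n with _ | n
  · simp
  · exact ((birkhoffSum_succ_le_birkhoffMax n x).trans (h n).le).trans (le_max_right _ _)

variable [MeasurableSpace X]

lemma measurable_birkhoffMax (hS : Measurable S) (hf : Measurable f) (n : ℕ) :
    Measurable (birkhoffMax S f n) := by
  induction n with
  | zero => exact hf
  | succ n ih => exact hf.add (measurable_const.max (ih.comp hS))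

lemma integrable_birkhoffMax {ν : Measure X} (hS : MeasurePreserving S ν ν)
    (hfi : Integrable f ν) (n : ℕ) : Integrable (birkhoffMax S f n) ν := by
  induction n with
  | zero => exact hfi
  | succ n ih =>
    exact hfi.add ((integrable_zero X ℝ ν).sup (hS.integrable_comp_of_integrable ih))

lemma measurable_birkhoffSum (hS : Measurable S) (hf : Measurable f) (n : ℕ) :
    Measurable (birkhoffSum S f n) :=
  Finset.measurable_fun_sum _ fun k _ => hf.comp (hS.iterate k)

end birkhoffMax

lemma bddAbove_range_birkhoffSum_comp_iff {X : Type*} (S : X → X) (f : X → ℝ) (x : X) :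
    BddAbove (Set.range fun n => birkhoffSum S f n (S x)) ↔
      BddAbove (Set.range fun n => birkhoffSum S f n x) := by
  constructor
  · rintro ⟨b, hb⟩
    refine ⟨max 0 (f x + b), ?_⟩
    rintro _ ⟨n, rfl⟩
    rcases n with _ | n
    · simp
    · have : birkhoffSum S f n (S x) ≤ b := hb ⟨n, rfl⟩
      simp only [birkhoffSum_succ']
      exact (by linarith : f x + birkhoffSum S f n (S x) ≤ f x + b).trans (le_max_right _ _)
  · rintro ⟨b, hb⟩
    refine ⟨b - f x, ?_⟩
    rintro _ ⟨n, rfl⟩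
    have : birkhoffSum S f (n + 1) x ≤ b := hb ⟨n + 1, rfl⟩
    rw [birkhoffSum_succ'] at this
    simp only
    linarith

/-- A maximal ergodic theorem: if the Birkhoff sums are almost surely unbounded above,
then the integral is nonnegative. -/
lemma integral_nonneg_of_birkhoffSum_unbounded {X : Type*} [MeasurableSpace X] {S : X → X}
    {ν : Measure X} (hS : MeasurePreserving S ν ν) {f : X → ℝ} (hf : Measurable f)
    (hfi : Integrable f ν)
    (h : ∀ᵐ x ∂ν, ¬ BddAbove (Set.range fun n => birkhoffSum S f n x)) :
    0 ≤ ∫ x, f x ∂ν := by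
  have hlim : Tendsto (fun n => ∫ x, min 0 (birkhoffMax S f n (S x)) ∂ν) atTop (𝓝 0) := by
    suffices Tendsto (fun n => ∫ x, min 0 (birkhoffMax S f n (S x)) ∂ν) atTop
        (𝓝 (∫ _, (0 : ℝ) ∂ν)) by simpa using this
    refine tendsto_integral_of_dominated_convergence (fun x => |f (S x)|) (fun n => ?_)
      (hS.integrable_comp_of_integrable hfi).abs (fun n => ae_of_all _ fun x => ?_) ?_
    · exact (measurable_const.min
        ((measurable_birkhoffMax hS.measurable hf n).comp hS.measurable)).aestronglyMeasurable
    · have h0 : f (S x) ≤ birkhoffMax S f n (S x) := birkhoffMax_mono (S x) (Nat.zero_le n)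
      rw [Real.norm_eq_abs, abs_of_nonpos (min_le_left _ _)]
      rcases min_cases 0 (birkhoffMax S f n (S x)) with h1 | h1
      · rw [h1.1]; simp
      · rw [h1.1]; linarith [neg_abs_le (f (S x))]
    · filter_upwards [h] with x hx
      have hx' := tendsto_birkhoffMax_atTop (mt (bddAbove_range_birkhoffSum_comp_iff S f x).1 hx)
      refine tendsto_const_nhds.congr' ?_
      filter_upwards [hx'.eventually_ge_atTop 0] with n hn
      exact (min_eq_left hn).symm
  refine le_of_tendsto' hlim fun n => ?_
  have hM := integrable_birkhoffMax hS hfi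
  have hMS : Integrable (fun x => birkhoffMax S f n (S x)) ν :=
    hS.integrable_comp_of_integrable (hM n)
  have hmin : Integrable (fun x => min 0 (birkhoffMax S f n (S x))) ν :=
    (integrable_zero X ℝ ν).inf hMS
  have hcomp : ∫ x, birkhoffMax S f n (S x) ∂ν = ∫ x, birkhoffMax S f n x ∂ν := by
    rw [← integral_map hS.measurable.aemeasurable
      (by rw [hS.map_eq]; exact (hM n).aestronglyMeasurable), hS.map_eq]
  have hmono : ∫ x, birkhoffMax S f n x ∂ν ≤ ∫ x, birkhoffMax S f (n + 1) x ∂ν :=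
    integral_mono (hM n) (hM (n + 1)) (birkhoffMax_le_succ n)
  have hrec : ∫ x, birkhoffMax S f (n + 1) x ∂ν =
      ∫ x, f x ∂ν - ∫ x, min 0 (birkhoffMax S f n (S x)) ∂ν
        + ∫ x, birkhoffMax S f n (S x) ∂ν := by
    have hsub : Integrable (fun x => f x - min 0 (birkhoffMax S f n (S x))) ν := hfi.sub hmin
    rw [← integral_sub hfi hmin, ← integral_add hsub hMS]
    refine integral_congr_ae (ae_of_all _ fun x => ?_)
    have := min_add_max 0 (birkhoffMax S f n (S x))
    simp only [birkhoffMax]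
    linarith
  linarith

lemma Ergodic.ae_bddAbove_birkhoffSum {X : Type*} [MeasurableSpace X] {S : X → X}
    {ν : Measure X} (hS : Ergodic S ν) {f : X → ℝ} (hf : Measurable f)
    (hfi : Integrable f ν) (hneg : ∫ x, f x ∂ν < 0) :
    ∀ᵐ x ∂ν, BddAbove (Set.range fun n => birkhoffSum S f n x) := by
  refine (hS.ae_mem_or_ae_notMem (measurableSet_bddAbove_range
    (measurable_birkhoffSum hS.measurable hf)) ?_).resolve_right fun h => ?_
  · ext x
    exact bddAbove_range_birkhoffSum_comp_iff S f x
  · exact hneg.not_ge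
      (integral_nonneg_of_birkhoffSum_unbounded hS.toMeasurePreserving hf hfi h)

lemma Ergodic.ae_eventually_birkhoffSum_le {X : Type*} [MeasurableSpace X] {S : X → X}
    {ν : Measure X} [IsProbabilityMeasure ν] (hS : Ergodic S ν) {f : X → ℝ} (hf : Measurable f)
    (hfi : Integrable f ν) :
    ∀ᵐ x ∂ν, ∀ ε > 0, ∀ᶠ n : ℕ in atTop,
      (n : ℝ)⁻¹ * birkhoffSum S f n x < ∫ y, f y ∂ν + ε := by
  have key : ∀ m : ℕ, ∀ᵐ x ∂ν, BddAbove (Set.range fun n =>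
      birkhoffSum S (fun y => f y - (∫ z, f z ∂ν + 1 / ((m : ℝ) + 1))) n x) := fun m => by
    refine hS.ae_bddAbove_birkhoffSum (hf.sub_const _) (hfi.sub (integrable_const _)) ?_
    rw [integral_sub hfi (integrable_const _)]
    have : (0 : ℝ) < 1 / ((m : ℝ) + 1) := by positivity
    simp only [integral_const, probReal_univ, one_smul]
    linarith
  filter_upwards [ae_all_iff.2 key] with x hx ε hε
  obtain ⟨m, hm⟩ := exists_nat_one_div_lt hε
  obtain ⟨b, hb⟩ := hx m
  have hlim : Tendsto (fun n : ℕ => (n : ℝ)⁻¹ * b) atTop (𝓝 0) := by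
    simpa using tendsto_inv_atTop_nhds_zero_nat (𝕜 := ℝ) |>.mul_const b
  filter_upwards [hlim.eventually_lt_const (sub_pos.2 hm), eventually_gt_atTop 0] with n hn hn0
  have h1 : birkhoffSum S (fun y => f y - (∫ z, f z ∂ν + 1 / ((m : ℝ) + 1))) n x ≤ b :=
    hb ⟨n, rfl⟩
  have h2 : birkhoffSum S (fun y => f y - (∫ z, f z ∂ν + 1 / ((m : ℝ) + 1))) n x =
      birkhoffSum S f n x - n * (∫ z, f z ∂ν + 1 / ((m : ℝ) + 1)) := by
    simp [birkhoffSum, Finset.sum_sub_distrib, mul_add]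
  have hn1 : (0 : ℝ) < n := by exact_mod_cast hn0
  have h3 : (n : ℝ)⁻¹ * birkhoffSum S f n x ≤
      (n : ℝ)⁻¹ * b + (∫ z, f z ∂ν + 1 / ((m : ℝ) + 1)) := by
    rw [h2] at h1
    calc (n : ℝ)⁻¹ * birkhoffSum S f n x
        ≤ (n : ℝ)⁻¹ * (b + n * (∫ z, f z ∂ν + 1 / ((m : ℝ) + 1))) := by
          gcongr; linarith
      _ = _ := by field_simp
  linarith

/-- The pointwise ergodic theorem for an ergodic transformation of a probability space. -/
theorem Ergodic.ae_tendsto_birkhoffSum {X : Type*} [MeasurableSpace X] {S : X → X}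
    {ν : Measure X} [IsProbabilityMeasure ν] (hS : Ergodic S ν) {f : X → ℝ} (hf : Measurable f)
    (hfi : Integrable f ν) :
    ∀ᵐ x ∂ν, Tendsto (fun n : ℕ => (n : ℝ)⁻¹ * birkhoffSum S f n x) atTop
      (𝓝 (∫ y, f y ∂ν)) := by
  filter_upwards [hS.ae_eventually_birkhoffSum_le hf hfi,
    hS.ae_eventually_birkhoffSum_le hf.neg hfi.neg] with x h1 h2
  refine tendsto_order.2 ⟨fun a ha => ?_, fun a ha => ?_⟩
  · filter_upwards [h2 _ (sub_pos.2 ha)] with n hn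
    simp only [Pi.neg_apply, integral_neg, birkhoffSum, Finset.sum_neg_distrib] at hn ⊢
    linarith
  · filter_upwards [h1 _ (sub_pos.2 ha)] with n hn
    linarith

/-- The product of a weak mixing system with an ergodic system is ergodic. -/
theorem WeakMixing.prodMap_preErgodic {Ω X : Type*} [MeasurableSpace Ω] [MeasurableSpace X]
    [MeasurableSpace.CountablyGenerated X] {T : Ω → Ω} {μ : Measure Ω} [IsProbabilityMeasure μ]
    (hT : MeasurePreserving T μ μ) (hwm : WeakMixing T μ) {R : X → X} {ρ : Measure X}
    [IsFiniteMeasure ρ] (hR : Ergodic R ρ) :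
    PreErgodic (Prod.map T R) (μ.prod ρ) := by
  refine ⟨fun A hA hinv => ?_⟩
  have hinv' : ∀ ω x, (T ω, R x) ∈ A ↔ (ω, x) ∈ A := fun ω x => by
    conv_rhs => rw [← hinv]
    rfl
  set sec : Ω → Set X := fun ω => Prod.mk ω ⁻¹' A
  have hsecm : ∀ ω, MeasurableSet (sec ω) := fun ω => measurable_prodMk_left hA
  have hsecR : ∀ ω, R ⁻¹' sec (T ω) = sec ω := fun ω => by
    ext x
    exact hinv' ω x
  set d : Ω × Ω → ENNReal := fun p => ρ (symmDiff (sec p.1) (sec p.2)) with hd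
  have hdm : Measurable d := by
    have h1 : MeasurableSet {q : (Ω × Ω) × X | (q.1.1, q.2) ∈ A} :=
      (by fun_prop : Measurable fun q : (Ω × Ω) × X => (q.1.1, q.2)) hA
    have h2 : MeasurableSet {q : (Ω × Ω) × X | (q.1.2, q.2) ∈ A} :=
      (by fun_prop : Measurable fun q : (Ω × Ω) × X => (q.1.2, q.2)) hA
    exact measurable_measure_prodMk_left (h1.symmDiff h2)
  have hdinv : ∀ p, d (Prod.map T T p) = d p := fun p => by
    simp only [hd, Prod.map_fst, Prod.map_snd]
    rw [← hR.measure_preimage ((hsecm _).symmDiff (hsecm _)).nullMeasurableSet,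
      Set.preimage_symmDiff, hsecR, hsecR]
  obtain ⟨𝒜, h𝒜c, h𝒜⟩ := exists_countable_measureDense ρ
  have hsmall : ∀ n : ℕ, ∀ᵐ p ∂μ.prod μ, d p < 2 * ENNReal.ofReal (1 / ((n : ℝ) + 1)) := by
    intro n
    set ε : ℝ := 1 / ((n : ℝ) + 1)
    have hε : 0 < ε := by positivity
    refine (hwm.ae_mem_or_ae_notMem (s := {p | d p < 2 * ENNReal.ofReal ε})
      (measurableSet_lt hdm measurable_const) ?_).resolve_right fun hnot => ?_
    · ext p
      simp only [Set.mem_preimage, Set.mem_ofPred_eq, hdinv]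
    · have hE : ∀ B ∈ 𝒜, μ {ω | ρ (symmDiff (sec ω) B) < ENNReal.ofReal ε} = 0 := by
        intro B _
        set E := {ω | ρ (symmDiff (sec ω) B) < ENNReal.ofReal ε}
        have hEE : (μ.prod μ) (E ×ˢ E) = 0 := by
          refine measure_mono_null ?_ (ae_iff.1 hnot)
          rintro ⟨ω, ω'⟩ ⟨h1, h2⟩
          simp only [not_not, Set.mem_ofPred_eq, hd, E] at h1 h2 ⊢
          calc ρ (symmDiff (sec ω) (sec ω'))
              ≤ ρ (symmDiff (sec ω) B) + ρ (symmDiff B (sec ω')) :=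
                measure_symmDiff_le _ _ _
            _ < ENNReal.ofReal ε + ENNReal.ofReal ε :=
                ENNReal.add_lt_add h1 (by rwa [symmDiff_comm])
            _ = _ := (two_mul _).symm
        rw [Measure.prod_prod] at hEE
        exact mul_self_eq_zero.1 hEE
      have huniv : μ (⋃ B ∈ 𝒜, {ω | ρ (symmDiff (sec ω) B) < ENNReal.ofReal ε}) = 0 :=
        (measure_biUnion_null_iff h𝒜c).2 hE
      have : (⋃ B ∈ 𝒜, {ω | ρ (symmDiff (sec ω) B) < ENNReal.ofReal ε}) = Set.univ := by
        refine Set.eq_univ_of_forall fun ω => ?_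
        obtain ⟨B, hB, h⟩ := h𝒜.approx (sec ω) (hsecm ω) (measure_ne_top _ _) ε hε
        exact Set.mem_biUnion hB h
      rw [this, measure_univ] at huniv
      exact one_ne_zero huniv
  have hzero : ∀ᵐ p ∂μ.prod μ, d p = 0 := by
    filter_upwards [ae_all_iff.2 hsmall] with p hp
    have hlim : Tendsto (fun n : ℕ => 2 * ENNReal.ofReal (1 / ((n : ℝ) + 1))) atTop (𝓝 0) := by
      have := ENNReal.tendsto_ofReal (tendsto_one_div_add_atTop_nhds_zero_nat (𝕜 := ℝ))
      simpa using ENNReal.Tendsto.const_mul this (Or.inr ENNReal.ofNat_ne_top)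
    exact le_antisymm (ge_of_tendsto' hlim fun n => (hp n).le) zero_le
  obtain ⟨ω₀, hω₀⟩ := (Measure.ae_ae_of_ae_prod hzero).exists
  have hsec₀ : ∀ᵐ ω ∂μ, sec ω₀ =ᵐ[ρ] sec ω := by
    filter_upwards [hω₀] with ω hω
    exact measure_symmDiff_eq_zero_iff.1 hω
  obtain ⟨ω₁, h1, h2⟩ := (hsec₀.and (hT.quasiMeasurePreserving.ae hsec₀)).exists
  have hinv₀ : R ⁻¹' sec ω₀ =ᵐ[ρ] sec ω₀ := by
    have := hR.quasiMeasurePreserving.preimage_ae_eq h2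
    rw [hsecR] at this
    exact this.trans h1.symm
  rw [eventuallyConst_set]
  refine (hR.quasiErgodic.ae_mem_or_ae_notMem₀ (hsecm ω₀).nullMeasurableSet hinv₀).imp
    (fun h => ?_) fun h => ?_
  · refine (Measure.ae_prod_iff_ae_ae hA).2 ?_
    filter_upwards [hsec₀] with ω hω
    filter_upwards [h, hω.mem_iff] with x hx hx'
    exact hx'.1 hx
  · refine (Measure.ae_prod_iff_ae_ae hA.compl).2 ?_
    filter_upwards [hsec₀] with ω hω
    filter_upwards [h, hω.mem_iff] with x hx hx'
    exact fun hmem => hx (hx'.2 hmem)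

/-- The skew product over the rotation by `α` on `[0, 1)` which applies `T` each time the
rotation wraps around. -/
noncomputable def wrapSkew {Ω : Type*} (α : ℝ) (T : Ω → Ω) (p : ℝ × Ω) : ℝ × Ω :=
  (Int.fract (p.1 + α), T^[⌊p.1 + α⌋.toNat] p.2)

lemma wrapSkew_of_lt {Ω : Type*} {α : ℝ} (T : Ω → Ω) {t : ℝ} (ω : Ω) (h0 : 0 ≤ t + α)
    (h1 : t + α < 1) : wrapSkew α T (t, ω) = (t + α, ω) := by
  have hfl : ⌊t + α⌋ = 0 := Int.floor_eq_zero_iff.2 ⟨h0, h1⟩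
  simp [wrapSkew, hfl, Int.fract]

lemma wrapSkew_iterate {Ω : Type*} {α : ℝ} (hα : 0 ≤ α) (T : Ω → Ω) {t : ℝ}
    (ht : t ∈ Set.Ico (0 : ℝ) 1) (ω : Ω) (k : ℕ) :
    (wrapSkew α T)^[k] (t, ω) = (Int.fract (t + k * α), T^[lk α t k] ω) := by
  induction k with
  | zero =>
    have hfl : ⌊t⌋ = 0 := Int.floor_eq_zero_iff.2 ht
    simp [lk, hfl, Int.fract_eq_self.2 ht]
  | succ k ih =>
    have hsum : t + ((k + 1 : ℕ) : ℝ) * α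
        = Int.fract (t + k * α) + α + (⌊t + k * α⌋ : ℤ) := by
      rw [Int.fract]; push_cast; ring
    have hk : 0 ≤ ⌊t + k * α⌋ := Int.floor_nonneg.2 (add_nonneg ht.1 (by positivity))
    have hk' : 0 ≤ ⌊Int.fract (t + k * α) + α⌋ :=
      Int.floor_nonneg.2 (add_nonneg (Int.fract_nonneg _) hα)
    have hlk : lk α t (k + 1) = ⌊Int.fract (t + k * α) + α⌋.toNat + lk α t k := by
      rw [lk, lk, mul_comm α, mul_comm α, hsum, Int.floor_add_intCast, Int.toNat_add hk' hk]
    rw [Function.iterate_succ_apply', ih, hlk, Function.iterate_add_apply, hsum,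
      Int.fract_add_intCast]
    rfl

lemma measurePreserving_fract_add (α : ℝ) :
    MeasurePreserving (fun t => Int.fract (t + α)) (volume.restrict (Set.Ico (0 : ℝ) 1))
      (volume.restrict (Set.Ico (0 : ℝ) 1)) := by
  set g : UnitAddCircle → ℝ := fun x => (AddCircle.equivIco 1 0 x : ℝ)
  have hgm : Measurable g :=
    measurable_subtype_coe.comp (AddCircle.measurableEquivIco 1 0).measurable
  have hgf : ∀ x : ℝ, g x = Int.fract x := fun x =>
    (AddCircle.coe_equivIco_mk_apply (1 : ℝ) x).trans (by rw [div_one, mul_one])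
  have hmk : MeasurePreserving ((↑) : ℝ → UnitAddCircle)
      (volume.restrict (Set.Ico (0 : ℝ) 1)) volume := by
    rw [restrict_Ico_eq_restrict_Ioc]
    simpa using UnitAddCircle.measurePreserving_mk 0
  have hg' : MeasurePreserving g volume (volume.restrict (Set.Ico (0 : ℝ) 1)) := by
    refine ⟨hgm, ?_⟩
    rw [← hmk.map_eq, Measure.map_map hgm hmk.measurable]
    conv_rhs => rw [← Measure.map_id (μ := volume.restrict (Set.Ico (0 : ℝ) 1))]
    refine Measure.map_congr ?_
    filter_upwards [ae_restrict_mem measurableSet_Ico] with t ht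
    simp [hgf, Int.fract_eq_self.2 ht]
  have := hg'.comp ((measurePreserving_add_right volume (α : UnitAddCircle)).comp hmk)
  convert this using 1
  ext t
  simp only [Function.comp_apply, ← hgf, AddCircle.coe_add]

lemma measurePreserving_wrapSkew {Ω : Type*} [MeasurableSpace Ω] {T : Ω → Ω} {μ : Measure Ω}
    [IsProbabilityMeasure μ] (hT : MeasurePreserving T μ μ) (α : ℝ) :
    MeasurePreserving (wrapSkew α T) ((volume.restrict (Set.Ico (0 : ℝ) 1)).prod μ)
      ((volume.restrict (Set.Ico (0 : ℝ) 1)).prod μ) := by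
  refine (measurePreserving_fract_add α).skew_product
    (g := fun t ω => T^[⌊t + α⌋.toNat] ω) ?_ (ae_of_all _ fun t => (hT.iterate _).map_eq)
  have h1 : Measurable (Function.uncurry fun (ω : Ω) (n : ℕ) => T^[n] ω) :=
    measurable_from_prod_countable_left fun n => hT.measurable.iterate n
  exact h1.comp (measurable_snd.prodMk
    ((measurable_from_top (f := Int.toNat)).comp
      (Int.measurable_floor.comp (measurable_fst.add_const α))))

lemma quasiMeasurePreserving_addCircle_mk (p : ℝ) [hp : Fact (0 < p)] :
    Measure.QuasiMeasurePreserving ((↑) : ℝ → AddCircle p) volume volume := by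
  refine ⟨AddCircle.measurable_mk', Measure.AbsolutelyContinuous.mk fun s hs h => ?_⟩
  rw [Measure.map_apply AddCircle.measurable_mk' hs]
  have hU : ⋃ n : ℤ, Set.Ioc (n • p) ((n + 1) • p) = Set.univ := iUnion_Ioc_zsmul hp.out
  rw [← Set.inter_univ ((↑) ⁻¹' s : Set ℝ), ← hU, Set.inter_iUnion, measure_iUnion_null_iff]
  intro n
  have := (AddCircle.measurePreserving_mk p (n • p)).measure_preimage hs.nullMeasurableSet
  rw [h, Measure.restrict_apply (AddCircle.measurable_mk' hs)] at this
  rwa [add_zsmul, one_zsmul]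

theorem ergodic_wrapSkew {Ω : Type*} [MeasurableSpace Ω] {T : Ω → Ω} {μ : Measure Ω}
    [IsProbabilityMeasure μ] (hT : MeasurePreserving T μ μ) (hwm : WeakMixing T μ) {α : ℝ}
    (hα : Irrational α) (hα01 : α ∈ Set.Ioo (0 : ℝ) 1) :
    Ergodic (wrapSkew α T) ((volume.restrict (Set.Ico (0 : ℝ) 1)).prod μ) := by
  refine ⟨measurePreserving_wrapSkew hT α, ⟨fun A hA hinv => ?_⟩⟩
  have hinv' : ∀ p, wrapSkew α T p ∈ A ↔ p ∈ A := fun p => by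
    conv_rhs => rw [← hinv]
    rfl
  have : Fact (0 < α) := ⟨hα01.1⟩
  have hR : Ergodic (fun x : AddCircle α => x + ((-1 : ℝ) : AddCircle α)) := by
    rw [AddCircle.ergodic_add_right, addOrderOf_eq_zero_iff,
      AddCircle.not_isOfFinAddOrder_iff_forall_rat_ne_div]
    intro q hq
    refine hα ⟨-q⁻¹, ?_⟩
    have := hα01.1.ne'
    push_cast
    rw [hq]
    field_simp
  set rep : AddCircle α → ℝ := fun x => (AddCircle.equivIco α 0 x : ℝ)
  have hrepm : Measurable rep :=
    measurable_subtype_coe.comp (AddCircle.measurableEquivIco α 0).measurable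
  have hrep0 : ∀ x, 0 ≤ rep x := fun x => (AddCircle.equivIco α 0 x).2.1
  have hrepα : ∀ x, rep x < α := fun x => by
    simpa using (AddCircle.equivIco α 0 x).2.2
  have hreps : ∀ x, ((rep x : ℝ) : AddCircle α) = x := fun x => AddCircle.coe_equivIco
  have hstep : ∀ (m : ℕ) (s : ℝ) (ω : Ω), 0 ≤ s → s + m * α < 1 →
      ((s + m * α, ω) ∈ A ↔ (s, ω) ∈ A) := by
    intro m s ω hs
    induction m with
    | zero => simp
    | succ m ih =>
      intro h
      have hsum : s + ((m + 1 : ℕ) : ℝ) * α = s + m * α + α := by push_cast; ring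
      rw [hsum] at h ⊢
      have hpos := hα01.1
      have hm : 0 ≤ s + m * α := by positivity
      rw [← ih (by linarith), ← hinv' (s + m * α, ω), wrapSkew_of_lt T ω (by linarith) h]
  have hmem : ∀ t ∈ Set.Ico (0 : ℝ) 1, ∀ ω, (t, ω) ∈ A ↔ (rep (t : AddCircle α), ω) ∈ A := by
    intro t ht ω
    have h1 : rep (t : AddCircle α) = Int.fract (t / α) * α :=
      AddCircle.coe_equivIco_mk_apply α t
    have h0 : 0 ≤ ⌊t / α⌋ := Int.floor_nonneg.2 (div_nonneg ht.1 hα01.1.le)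
    have h2 : t = rep (t : AddCircle α) + (⌊t / α⌋.toNat : ℝ) * α := by
      have hc : ((⌊t / α⌋.toNat : ℕ) : ℝ) = (⌊t / α⌋ : ℝ) := by
        exact_mod_cast congrArg (Int.cast (R := ℝ)) (Int.toNat_of_nonneg h0)
      rw [h1, hc, ← add_mul, Int.fract_add_floor, div_mul_cancel₀ _ hα01.1.ne']
    have := hstep ⌊t / α⌋.toNat (rep (t : AddCircle α)) ω (hrep0 _) (by rw [← h2]; exact ht.2)
    rwa [← h2] at this
  set A' : Set (Ω × AddCircle α) := {q | (rep q.2, q.1) ∈ A}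
  have hA'm : MeasurableSet A' :=
    ((hrepm.comp measurable_snd).prodMk measurable_fst) hA
  have hA'inv : Prod.map T (fun x : AddCircle α => x + ((-1 : ℝ) : AddCircle α)) ⁻¹' A' = A' := by
    ext ⟨ω, x⟩
    set y : AddCircle α := x + ((-1 : ℝ) : AddCircle α) with hy
    have hyα := hrepα y
    have hy0 := hrep0 y
    have hα1 := hα01.2
    change (rep y, T ω) ∈ A ↔ (rep x, ω) ∈ A
    have hx : ((rep y + 1 - α : ℝ) : AddCircle α) = x := by
      rw [AddCircle.coe_sub, AddCircle.coe_add, hreps, AddCircle.coe_period, hy,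
        AddCircle.coe_neg]
      abel
    have hfl : ⌊rep y + 1⌋ = 1 := by
      rw [Int.floor_eq_iff]
      constructor <;> push_cast <;> linarith
    have hS : wrapSkew α T (rep y + 1 - α, ω) = (rep y, T ω) := by
      simp only [wrapSkew, sub_add_cancel, hfl, Int.fract]
      simp
    rw [← hS, hinv', hmem _ ⟨by linarith, by linarith⟩, hx]
  have hconst := (hwm.prodMap_preErgodic hT hR).ae_mem_or_ae_notMem hA'm hA'inv
  have hq : Measure.QuasiMeasurePreserving (fun p : ℝ × Ω => (p.2, (p.1 : AddCircle α)))
      ((volume.restrict (Set.Ico (0 : ℝ) 1)).prod μ) (μ.prod volume) := by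
    have h1 : Measure.QuasiMeasurePreserving ((↑) : ℝ → AddCircle α)
        (volume.restrict (Set.Ico (0 : ℝ) 1)) volume :=
      (quasiMeasurePreserving_addCircle_mk α).mono_left
        Measure.restrict_le_self.absolutelyContinuous
    exact (QuasiMeasurePreserving.prodMap (.id μ) h1).comp
      Measure.measurePreserving_swap.quasiMeasurePreserving
  have hI : ∀ᵐ p ∂(volume.restrict (Set.Ico (0 : ℝ) 1)).prod μ, p.1 ∈ Set.Ico (0 : ℝ) 1 :=
    Measure.quasiMeasurePreserving_fst.ae (ae_restrict_mem measurableSet_Ico)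
  rw [eventuallyConst_set]
  refine hconst.imp (fun h => ?_) fun h => ?_
  · filter_upwards [hq.ae h, hI] with p hp hp1
    exact (hmem p.1 hp1 p.2).2 hp
  · filter_upwards [hq.ae h, hI] with p hp hp1
    exact fun hpA => hp ((hmem p.1 hp1 p.2).1 hpA)

/-- The ergodic theorem along an almost surely convergent, uniformly bounded sequence of
functions. -/
theorem Ergodic.ae_tendsto_sum_of_tendsto {X : Type*} [MeasurableSpace X] {S : X → X}
    {ν : Measure X} [IsProbabilityMeasure ν] (hS : Ergodic S ν) {g : ℕ → X → ℝ} {f : X → ℝ}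
    (hg : ∀ k, Measurable (g k)) {C : ℝ} (hC : ∀ k x, |g k x| ≤ C)
    (hlim : ∀ᵐ x ∂ν, Tendsto (fun k => g k x) atTop (𝓝 (f x))) :
    ∀ᵐ x ∂ν, Tendsto (fun N : ℕ => (N : ℝ)⁻¹ * ∑ k ∈ Finset.range N, g k (S^[k] x)) atTop
      (𝓝 (∫ y, f y ∂ν)) := by
  have hfm : AEStronglyMeasurable f ν :=
    aestronglyMeasurable_of_tendsto_ae atTop (fun k => (hg k).aestronglyMeasurable) hlim
  set f' := hfm.mk f
  have hf'm : Measurable f' := hfm.stronglyMeasurable_mk.measurable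
  have hint : ∫ y, f y ∂ν = ∫ y, f' y ∂ν := integral_congr_ae hfm.ae_eq_mk
  have hlim' : ∀ᵐ x ∂ν, Tendsto (fun k => g k x) atTop (𝓝 (f' x)) := by
    filter_upwards [hlim, hfm.ae_eq_mk] with x hx hx'
    rwa [hx'] at hx
  have hf'C : ∀ᵐ x ∂ν, |f' x| ≤ C := by
    filter_upwards [hlim'] with x hx
    exact le_of_tendsto' hx.abs fun k => hC k x
  have hf'i : Integrable f' ν := Integrable.of_bound hf'm.aestronglyMeasurable C hf'C
  set G : ℕ → X → ℝ := fun K x => ⨆ k, |g (k + K) x - f' x|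
  have hGm : ∀ K, Measurable (G K) := fun K =>
    Measurable.iSup fun k => (measurable_norm.comp ((hg (k + K)).sub hf'm))
  have hdiff : ∀ k x, |g k x - f' x| ≤ C + |f' x| := fun k x =>
    (abs_sub _ _).trans (by linarith [hC k x])
  have hbdd : ∀ K x, BddAbove (Set.range fun k => |g (k + K) x - f' x|) := fun K x =>
    ⟨C + |f' x|, by rintro _ ⟨k, rfl⟩; exact hdiff _ x⟩
  have hGle : ∀ K x, G K x ≤ C + |f' x| := fun K x => ciSup_le fun k => hdiff _ x
  have hG0 : ∀ K x, 0 ≤ G K x := fun K x => Real.iSup_nonneg fun k => abs_nonneg _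
  have hGb : ∀ K, ∀ᵐ x ∂ν, ‖G K x‖ ≤ C + C := fun K => by
    filter_upwards [hf'C] with x hx
    rw [Real.norm_eq_abs, abs_of_nonneg (hG0 K x)]
    linarith [hGle K x]
  have hGi : ∀ K, Integrable (G K) ν := fun K =>
    Integrable.of_bound (hGm K).aestronglyMeasurable _ (hGb K)
  have hGlim : Tendsto (fun K => ∫ x, G K x ∂ν) atTop (𝓝 0) := by
    have : Tendsto (fun K => ∫ x, G K x ∂ν) atTop (𝓝 (∫ _, (0 : ℝ) ∂ν)) := by
      refine tendsto_integral_of_dominated_convergence (fun _ => C + C)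
        (fun K => (hGm K).aestronglyMeasurable) (integrable_const _) hGb ?_
      filter_upwards [hlim'] with x hx
      refine tendsto_order.2 ⟨fun a ha => .of_forall fun K => ha.trans_le (hG0 K x),
        fun a ha => ?_⟩
      obtain ⟨K₀, hK₀⟩ := Metric.tendsto_atTop.1 hx (a / 2) (half_pos ha)
      filter_upwards [eventually_ge_atTop K₀] with K hK
      refine (ciSup_le fun k => ?_).trans_lt (half_lt_self ha)
      exact (hK₀ (k + K) (by omega)).le
    simpa using this
  filter_upwards [hS.ae_tendsto_birkhoffSum hf'm hf'i,
    ae_all_iff.2 fun K => hS.ae_tendsto_birkhoffSum (hGm K) (hGi K)] with x hx hxG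
  rw [hint, Metric.tendsto_atTop']
  intro ε hε
  obtain ⟨K, hK⟩ := (hGlim.eventually_lt_const (by positivity : 0 < ε / 4)).exists
  set D : ℝ := ∑ k ∈ Finset.range K, |g k (S^[k] x) - f' (S^[k] x)|
  have hD : Tendsto (fun N : ℕ => (N : ℝ)⁻¹ * D) atTop (𝓝 0) := by
    simpa using tendsto_inv_atTop_nhds_zero_nat (𝕜 := ℝ) |>.mul_const D
  have hev : ∀ᶠ N : ℕ in atTop, dist ((N : ℝ)⁻¹ * ∑ k ∈ Finset.range N, g k (S^[k] x))
      (∫ y, f' y ∂ν) < ε := by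
    filter_upwards [hD.eventually_lt_const (by positivity : 0 < ε / 4),
      (hxG K).eventually_lt_const (by linarith : ∫ y, G K y ∂ν < ε / 2),
      Metric.tendsto_nhds.1 hx (ε / 4) (by positivity)] with N h1 h2 h3
    have hN : (0 : ℝ) ≤ (N : ℝ)⁻¹ := by positivity
    have hsum : ∑ k ∈ Finset.range N, |g k (S^[k] x) - f' (S^[k] x)|
        ≤ D + birkhoffSum S (G K) N x := by
      calc ∑ k ∈ Finset.range N, |g k (S^[k] x) - f' (S^[k] x)|
          ≤ ∑ k ∈ Finset.range N,
            ((if k < K then |g k (S^[k] x) - f' (S^[k] x)| else 0) + G K (S^[k] x)) := by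
            refine Finset.sum_le_sum fun k _ => ?_
            split_ifs with hk
            · linarith [hG0 K (S^[k] x)]
            · rw [zero_add]
              obtain ⟨j, rfl⟩ := Nat.exists_eq_add_of_le' (not_lt.1 hk)
              exact le_ciSup (hbdd K (S^[j + K] x)) j
        _ ≤ _ := by
            rw [Finset.sum_add_distrib, ← Finset.sum_filter]
            refine add_le_add_left (Finset.sum_le_sum_of_subset_of_nonneg (fun k hk => ?_)
              fun _ _ _ => abs_nonneg _) _
            exact Finset.mem_range.2 (Finset.mem_filter.1 hk).2
    have hdist : dist ((N : ℝ)⁻¹ * ∑ k ∈ Finset.range N, g k (S^[k] x))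
        ((N : ℝ)⁻¹ * birkhoffSum S f' N x) ≤
        (N : ℝ)⁻¹ * D + (N : ℝ)⁻¹ * birkhoffSum S (G K) N x := by
      rw [Real.dist_eq, ← mul_sub, birkhoffSum, ← Finset.sum_sub_distrib, abs_mul,
        abs_of_nonneg hN, ← mul_add]
      exact mul_le_mul_of_nonneg_left ((Finset.abs_sum_le_sum_abs _ _).trans hsum) hN
    have := dist_triangle ((N : ℝ)⁻¹ * ∑ k ∈ Finset.range N, g k (S^[k] x))
      ((N : ℝ)⁻¹ * birkhoffSum S f' N x) (∫ y, f' y ∂ν)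
    linarith
  obtain ⟨N₀, hN₀⟩ := eventually_atTop.1 hev
  exact ⟨N₀, fun N hN => hN₀ N hN.le⟩

theorem Ergodic.ae_tendsto_sum_Icc_of_tendsto {X : Type*} [MeasurableSpace X] {S : X → X}
    {ν : Measure X} [IsProbabilityMeasure ν] (hS : Ergodic S ν) {g : ℕ → X → ℝ} {f : X → ℝ}
    (hg : ∀ k, Measurable (g k)) {C : ℝ} (hC : ∀ k x, |g k x| ≤ C)
    (hlim : ∀ᵐ x ∂ν, Tendsto (fun k => g k x) atTop (𝓝 (f x))) :
    ∀ᵐ x ∂ν, Tendsto (fun N : ℕ => (N : ℝ)⁻¹ * ∑ k ∈ Finset.Icc 1 N, g k (S^[k] x)) atTop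
      (𝓝 (∫ y, f y ∂ν)) := by
  have hfm : AEStronglyMeasurable f ν :=
    aestronglyMeasurable_of_tendsto_ae atTop (fun k => (hg k).aestronglyMeasurable) hlim
  have hint : ∫ y, f (S y) ∂ν = ∫ y, f y ∂ν := by
    rw [← integral_map hS.measurable.aemeasurable (by rwa [hS.map_eq]), hS.map_eq]
  have := hS.ae_tendsto_sum_of_tendsto (g := fun k x => g (k + 1) (S x)) (f := fun x => f (S x))
    (fun k => (hg _).comp hS.measurable) (fun k x => hC _ _)
    (by
      filter_upwards [hS.quasiMeasurePreserving.ae hlim] with x hx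
      exact (tendsto_add_atTop_iff_nat 1).2 hx)
  filter_upwards [this] with x hx
  rw [hint] at hx
  refine hx.congr fun N => ?_
  have hIcc : Finset.Icc 1 N = Finset.Ico 1 (N + 1) := by
    ext k
    simp only [Finset.mem_Icc, Finset.mem_Ico]
    omega
  rw [hIcc, Finset.sum_Ico_eq_sum_range]
  simp only [Function.iterate_succ_apply', Nat.add_sub_cancel, add_comm 1]

/-- The points lying within `δ` to the right of `0` or of an endpoint of one of the intervals
`[p.1, p.2)`, `p ∈ s`. -/
def nearEndpoints (s : Finset (ℝ × ℝ)) (δ : ℝ) : Set ℝ :=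
  Set.Ico 0 δ ∪ ⋃ p ∈ s, (Set.Icc p.1 (p.1 + δ) ∪ Set.Icc p.2 (p.2 + δ))

lemma measurableSet_nearEndpoints (s : Finset (ℝ × ℝ)) (δ : ℝ) :
    MeasurableSet (nearEndpoints s δ) :=
  measurableSet_Ico.union
    (Finset.measurableSet_biUnion s fun _ _ => measurableSet_Icc.union measurableSet_Icc)

lemma volume_real_nearEndpoints_le (s : Finset (ℝ × ℝ)) {δ : ℝ} (hδ : 0 ≤ δ) :
    volume.real (nearEndpoints s δ) ≤ (2 * s.card + 1) * δ := by
  have h1 : volume.real (⋃ p ∈ s, (Set.Icc p.1 (p.1 + δ) ∪ Set.Icc p.2 (p.2 + δ)))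
      ≤ ∑ _p ∈ s, 2 * δ := by
    refine (measureReal_biUnion_finset_le _ _).trans (Finset.sum_le_sum fun p _ => ?_)
    refine (measureReal_union_le _ _).trans ?_
    rw [Real.volume_real_Icc_of_le (by linarith), Real.volume_real_Icc_of_le (by linarith)]
    linarith
  refine (measureReal_union_le _ _).trans ?_
  rw [Real.volume_real_Ico_of_le hδ]
  simp only [Finset.sum_const, nsmul_eq_mul] at h1
  linarith

lemma mem_iUnion_Ico_iff_of_notMem_nearEndpoints {s : Finset (ℝ × ℝ)} {δ η x : ℝ}
    (hx : x ∉ nearEndpoints s δ) (hη : 0 ≤ η) (hηδ : η ≤ δ) :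
    x - η ∈ ⋃ p ∈ s, Set.Ico p.1 p.2 ↔ x ∈ ⋃ p ∈ s, Set.Ico p.1 p.2 := by
  simp only [nearEndpoints, Set.mem_union, Set.mem_iUnion, not_or, not_exists, Set.mem_Icc,
    not_and, not_le] at hx
  simp only [Set.mem_iUnion, Set.mem_Ico, exists_prop]
  refine exists_congr fun p => and_congr_right fun hp => ?_
  obtain ⟨h1, h2⟩ := hx.2 p hp
  constructor
  · rintro ⟨h3, h4⟩
    refine ⟨by linarith, ?_⟩
    by_contra! h
    linarith [h2 h]
  · rintro ⟨h3, h4⟩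
    exact ⟨by linarith [h1 h3], by linarith⟩

lemma floor_fract_sub_of_le_fract {u η : ℝ} (hη : 0 ≤ η) (hu : η ≤ Int.fract u) :
    ⌊u - η⌋ = ⌊u⌋ ∧ Int.fract (u - η) = Int.fract u - η := by
  have hfl : ⌊u - η⌋ = ⌊u⌋ := by
    rw [Int.floor_eq_iff]
    have := Int.floor_add_fract u
    have := Int.fract_lt_one u
    constructor <;> linarith
  refine ⟨hfl, ?_⟩
  rw [Int.fract, hfl, Int.fract]
  ring

/-- Starting points within `δ` of each other give the same term, unless the orbit is near an
endpoint. -/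
lemma abs_term_sub_term_le {Ω : Type*} {T : Ω → Ω} {α C δ t t₀ : ℝ} {Fseq : ℕ → Ω → ℝ}
    (hC : ∀ k ω, |Fseq k ω| ≤ C) (s : Finset (ℝ × ℝ)) (ht : t ≤ t₀) (hδ : t₀ - t ≤ δ) (ω : Ω)
    (k : ℕ) :
    |(⋃ p ∈ s, Set.Ico p.1 p.2).indicator (1 : ℝ → ℝ) (Int.fract (t + k * α))
          * Fseq k (T^[lk α t k] ω)
        - (⋃ p ∈ s, Set.Ico p.1 p.2).indicator (1 : ℝ → ℝ) (Int.fract (t₀ + k * α))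
          * Fseq k (T^[lk α t₀ k] ω)|
      ≤ 2 * C * (nearEndpoints s δ).indicator (1 : ℝ → ℝ) (Int.fract (t₀ + k * α)) := by
  by_cases hx : Int.fract (t₀ + k * α) ∈ nearEndpoints s δ
  · have hb : ∀ t' : ℝ, |(⋃ p ∈ s, Set.Ico p.1 p.2).indicator (1 : ℝ → ℝ)
        (Int.fract (t' + k * α)) * Fseq k (T^[lk α t' k] ω)| ≤ C := fun t' => by
      have hF := hC k (T^[lk α t' k] ω)
      by_cases h : Int.fract (t' + k * α) ∈ ⋃ p ∈ s, Set.Ico p.1 p.2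
      · simpa [Set.indicator_of_mem h] using hF
      · simpa [Set.indicator_of_notMem h] using (abs_nonneg _).trans hF
    rw [Set.indicator_of_mem hx, Pi.one_apply, mul_one]
    exact (abs_sub _ _).trans (by linarith [hb t, hb t₀])
  · have hδx : δ ≤ Int.fract (t₀ + k * α) := by
      by_contra! h
      exact hx (Or.inl ⟨Int.fract_nonneg _, h⟩)
    have hη : 0 ≤ t₀ - t := sub_nonneg.2 ht
    obtain ⟨h1, h2⟩ := floor_fract_sub_of_le_fract hη (hδ.trans hδx)
    have hu : t₀ + k * α - (t₀ - t) = t + k * α := by ring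
    rw [hu] at h1 h2
    have hlk : lk α t k = lk α t₀ k := by rw [lk, lk, mul_comm α, h1]
    have hind : (⋃ p ∈ s, Set.Ico p.1 p.2).indicator (1 : ℝ → ℝ) (Int.fract (t + k * α))
        = (⋃ p ∈ s, Set.Ico p.1 p.2).indicator (1 : ℝ → ℝ) (Int.fract (t₀ + k * α)) := by
      have hmem := mem_iUnion_Ico_iff_of_notMem_nearEndpoints hx hη hδ
      rw [← h2] at hmem
      by_cases h : Int.fract (t₀ + k * α) ∈ ⋃ p ∈ s, Set.Ico p.1 p.2
      · rw [Set.indicator_of_mem h, Set.indicator_of_mem (hmem.2 h)]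
        rfl
      · rw [Set.indicator_of_notMem h, Set.indicator_of_notMem (mt hmem.1 h)]
    rw [Set.indicator_of_notMem hx, hlk, hind, sub_self, abs_zero, mul_zero]

theorem stmt4 {Ω : Type*} [MeasurableSpace Ω]
    (T : Ω → Ω) (μ : Measure Ω) [IsProbabilityMeasure μ]
    (hT : MeasurePreserving T μ μ) (hwm : WeakMixing T μ)
    (α : ℝ) (hα : Irrational α) (hα01 : α ∈ Set.Ioo (0 : ℝ) 1)
    (I : Set ℝ) (hI : IsFinUnionIntervals I) (hI01 : I ⊆ Set.Ico (0 : ℝ) 1)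
    (Fseq : ℕ → Ω → ℝ) (F : Ω → ℝ)
    (hmeas : ∀ k, Measurable (Fseq k))
    (hbd : ∃ C : ℝ, ∀ k ω, |Fseq k ω| ≤ C)
    (hconv : ∀ᵐ ω ∂μ, Tendsto (fun k => Fseq k ω) atTop (𝓝 (F ω))) :
    ∃ Ω' : Set Ω, μ Ω' = 1 ∧ ∀ ω ∈ Ω', ∀ t ∈ Set.Ico (0 : ℝ) 1,
      Tendsto (fun N : ℕ => (N : ℝ)⁻¹ *
          ∑ k ∈ Finset.Icc 1 N,
            Set.indicator I (1 : ℝ → ℝ) (Int.fract (t + k * α)) * Fseq k (T^[lk α t k] ω))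
        atTop (𝓝 ((volume I).toReal * ∫ ω', F ω' ∂μ)) := by
  obtain ⟨s, rfl⟩ := hI
  obtain ⟨C, hC⟩ := hbd
  set I : Set ℝ := ⋃ p ∈ s, Set.Ico p.1 p.2
  have hIm : MeasurableSet I := Finset.measurableSet_biUnion s fun _ _ => measurableSet_Ico
  set ρ : Measure ℝ := volume.restrict (Set.Ico (0 : ℝ) 1) with hρ
  have : IsProbabilityMeasure ρ := ⟨by simp [hρ]⟩
  have hS := ergodic_wrapSkew hT hwm hα hα01
  have hind : ∀ (J : Set ℝ) (x : ℝ), |J.indicator (1 : ℝ → ℝ) x| ≤ 1 := fun J x => by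
    by_cases h : x ∈ J <;> simp [h]
  have hmain := hS.ae_tendsto_sum_Icc_of_tendsto
    (g := fun k p => I.indicator (1 : ℝ → ℝ) p.1 * Fseq k p.2)
    (f := fun p => I.indicator (1 : ℝ → ℝ) p.1 * F p.2) (C := C)
    (fun k => ((measurable_one.indicator hIm).comp measurable_fst).mul
      ((hmeas k).comp measurable_snd))
    (fun k p => by
      rw [abs_mul]
      exact (mul_le_of_le_one_left (abs_nonneg _) (hind I _)).trans (hC k p.2))
    (by
      filter_upwards [Measure.quasiMeasurePreserving_snd.ae hconv] with p hp
      exact hp.const_mul _)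
  have hnear := fun n : ℕ => hS.ae_tendsto_sum_Icc_of_tendsto
    (g := fun _ p => (nearEndpoints s (1 / ((n : ℝ) + 1))).indicator (1 : ℝ → ℝ) p.1)
    (f := fun p => (nearEndpoints s (1 / ((n : ℝ) + 1))).indicator (1 : ℝ → ℝ) p.1) (C := 1)
    (fun _ => (measurable_one.indicator (measurableSet_nearEndpoints s _)).comp measurable_fst)
    (fun _ p => hind _ _) (ae_of_all _ fun _ => tendsto_const_nhds)
  have hintI : ∫ p, I.indicator (1 : ℝ → ℝ) p.1 * F p.2 ∂(ρ.prod μ)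
      = (volume I).toReal * ∫ ω', F ω' ∂μ := by
    rw [integral_prod_mul, integral_indicator_one hIm, hρ, measureReal_restrict_apply hIm,
      Set.inter_eq_left.2 hI01, Measure.real]
  have hintnear : ∀ n : ℕ,
      ∫ p, (nearEndpoints s (1 / ((n : ℝ) + 1))).indicator (1 : ℝ → ℝ) p.1 ∂(ρ.prod μ)
        ≤ (2 * s.card + 1) * (1 / ((n : ℝ) + 1)) := fun n => by
    have hm := measurableSet_nearEndpoints s (1 / ((n : ℝ) + 1))
    rw [integral_fun_fst (μ := ρ) (ν := μ)
      ((nearEndpoints s (1 / ((n : ℝ) + 1))).indicator (1 : ℝ → ℝ)), probReal_univ, one_smul,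
      integral_indicator_one hm, hρ, measureReal_restrict_apply hm]
    refine le_trans (measureReal_mono Set.inter_subset_left ?_)
      (volume_real_nearEndpoints_le s (by positivity))
    refine ((measure_union_le _ _).trans_lt (ENNReal.add_lt_top.2 ⟨by simp, ?_⟩)).ne
    exact measure_biUnion_lt_top s.finite_toSet fun p _ =>
      (measure_union_le _ _).trans_lt (ENNReal.add_lt_top.2 ⟨by simp, by simp⟩)
  rw [hintI] at hmain
  have hgood := Measure.ae_ae_of_ae_prod
    ((Measure.measurePreserving_swap (μ := μ) (ν := ρ)).quasiMeasurePreserving.ae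
      (hmain.and (ae_all_iff.2 hnear)))
  refine ⟨_, (measure_congr (eventuallyEq_univ.2 hgood)).trans measure_univ, fun ω hω t ht => ?_⟩
  have hC0 : 0 ≤ C := (abs_nonneg _).trans (hC 0 ω)
  have hdense := Measure.dense_of_ae ((ae_restrict_iff' measurableSet_Ico).1 hω)
  refine Metric.tendsto_nhds.2 fun ε hε => ?_
  set M : ℝ := 2 * C * (2 * s.card + 2) + 1 with hM
  have hM0 : 0 < M := by positivity
  obtain ⟨n, hn⟩ := exists_nat_one_div_lt (div_pos hε hM0)
  set δ : ℝ := 1 / ((n : ℝ) + 1)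
  have hδ0 : 0 < δ := by positivity
  rw [lt_div_iff₀ hM0] at hn
  obtain ⟨t₀, ht₀, ht₀1, ht₀2⟩ := hdense.exists_between
    (lt_min ht.2 (by linarith : t < t + δ))
  have ht₀I : t₀ ∈ Set.Ico (0 : ℝ) 1 :=
    ⟨ht.1.trans ht₀1.le, ht₀2.trans_le (min_le_left _ _)⟩
  have ht₀δ : t₀ - t ≤ δ := by linarith [ht₀2.trans_le (min_le_right _ _)]
  obtain ⟨h1, h2⟩ := ht₀ ht₀I
  replace h2 := h2 n
  simp only [Prod.swap_prod_mk, wrapSkew_iterate hα01.1.le T ht₀I] at h1 h2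
  filter_upwards [Metric.tendsto_nhds.1 h1 δ hδ0,
    h2.eventually_lt_const ((hintnear n).trans_lt (lt_add_of_pos_right _ hδ0))] with N hN1 hN2
  have hN : (0 : ℝ) ≤ (N : ℝ)⁻¹ := by positivity
  refine (dist_triangle _ ((N : ℝ)⁻¹ * ∑ k ∈ Finset.Icc 1 N,
    I.indicator (1 : ℝ → ℝ) (Int.fract (t₀ + k * α)) * Fseq k (T^[lk α t₀ k] ω)) _).trans_lt ?_
  have hd : dist ((N : ℝ)⁻¹ * ∑ k ∈ Finset.Icc 1 N,
        I.indicator (1 : ℝ → ℝ) (Int.fract (t + k * α)) * Fseq k (T^[lk α t k] ω))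
      ((N : ℝ)⁻¹ * ∑ k ∈ Finset.Icc 1 N,
        I.indicator (1 : ℝ → ℝ) (Int.fract (t₀ + k * α)) * Fseq k (T^[lk α t₀ k] ω))
      ≤ 2 * C * ((N : ℝ)⁻¹ * ∑ k ∈ Finset.Icc 1 N,
        (nearEndpoints s δ).indicator (1 : ℝ → ℝ) (Int.fract (t₀ + k * α))) := by
    rw [Real.dist_eq, ← mul_sub, ← Finset.sum_sub_distrib, abs_mul, abs_of_nonneg hN,
      mul_left_comm, Finset.mul_sum]
    exact mul_le_mul_of_nonneg_left ((Finset.abs_sum_le_sum_abs _ _).trans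
      (Finset.sum_le_sum fun k _ => abs_term_sub_term_le hC s ht₀1.le ht₀δ ω k)) hN
  have h3 := mul_le_mul_of_nonneg_left hN2.le (by positivity : 0 ≤ 2 * C)
  have h4 : δ * M = 2 * C * ((2 * s.card + 1) * δ + δ) + δ := by rw [hM]; ring
  linarith
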